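/- arXiv:0805.0564 — 3 statements merged into one kernel-verified Lean document; each statement's English description precedes it below -/
import Mathlib

section
/- Let R be a commutative ring, σ a finite type, and k ≥ 1 a natural number. Then in MvPolynomial σ R the element psum k − (−1)^(k+1)·k·(esymm k) lies in the ideal generated by the elementary symmetric polynomials esymm 1, esymm 2, …, esymm (k−1). (Equivalently: modulo decomposable classes, i.e. modulo the lower elementary symmetric polynomials, the k-th power sum equals (−1)^(k+1)·k times the k-th elementary symmetric polynomial; this is the algebraic fact behind the paper's claim that the k-th Chern class evaluates to (k−1)! on the generator of π_{2k}(BU), and hence behind the fractional coefficients 1/2 and 1/6 in the obstruction classes.) -/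
open MvPolynomial

/-- Modulo the ideal generated by the lower elementary symmetric polynomials
`esymm 1, …, esymm (k−1)`, the `k`-th power sum equals `(−1)^(k+1)·k` times the `k`-th
elementary symmetric polynomial. -/
theorem psum_sub_smul_esymm_mem_span (R : Type*) [CommRing R] (σ : Type*) [Fintype σ]
    (k : ℕ) (hk : 1 ≤ k) :
    psum σ R k - (-1) ^ (k + 1) * (k : MvPolynomial σ R) * esymm σ R k ∈
      Ideal.span ((fun i => esymm σ R i) '' Set.Ico 1 k) := by
  rw [psum_eq_mul_esymm_sub_sum σ R k hk, sub_sub_cancel_left]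
  refine neg_mem (sum_mem fun a ha => ?_)
  have ha' : a.1 ∈ Set.Ioo 0 k := (Finset.mem_filter.mp ha).2
  exact Ideal.mul_mem_right _ _ (Ideal.mul_mem_left _ _
    (Ideal.subset_span ⟨a.1, ⟨ha'.1, ha'.2⟩, rfl⟩))
end

section
/- Let E be a finite-dimensional real inner product space and let x ∈ E be a unit vector (‖x‖ = 1). Then the stabilizer of x in the group of linear isometric equivalences of E, i.e. the subgroup {f : E ≃ₗᵢ[ℝ] E | f x = x}, is isomorphic as a group to the group of linear isometric equivalences of the orthogonal complement (ℝ∙x)ᗮ of the line spanned by x. (This identifies the stabilizer of a point of the sphere S^{n} under O(n+1) with O(n), the fact underlying the paper's fiber bundle O(n) → O(n+1) → S^n.) -/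
open Submodule

/-- The stabilizer of a point `x` in the group of linear isometric equivalences of a real
inner product space `E`: the subgroup of those `f` with `f x = x`. -/
def isometryStabilizer (E : Type*) [NormedAddCommGroup E] [InnerProductSpace ℝ E] (x : E) :
    Subgroup (E ≃ₗᵢ[ℝ] E) where
  carrier := {f | f x = x}
  one_mem' := rfl
  mul_mem' := by
    intro f g hf hg
    simp only [Set.mem_setOf_eq] at *
    show f (g x) = x
    rw [hg, hf]
  inv_mem' := by
    intro f hf
    simp only [Set.mem_setOf_eq] at *
    show f.symm x = x
    rw [← hf, f.symm_apply_apply, hf]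

section

variable {E : Type*} [NormedAddCommGroup E] [InnerProductSpace ℝ E]

/-- A linear isometric equivalence fixing `x` preserves the orthogonal complement of `x`. -/
theorem apply_mem_orthogonal_of_mem_isometryStabilizer {x : E} {f : E ≃ₗᵢ[ℝ] E}
    (hf : f ∈ isometryStabilizer E x) {v : E} (hv : v ∈ (ℝ ∙ x)ᗮ) : f v ∈ (ℝ ∙ x)ᗮ := by
  have hfx : f x = x := hf
  rw [mem_orthogonal_singleton_iff_inner_right] at hv ⊢
  rw [← hv, ← f.inner_map_map x v, hfx]

/-- Restriction of the isometries fixing `x` to the orthogonal complement of `x`. -/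
def isometryStabilizerRestrict (x : E) :
    isometryStabilizer E x →* ((ℝ ∙ x)ᗮ ≃ₗᵢ[ℝ] (ℝ ∙ x)ᗮ) where
  toFun f :=
    { toFun := fun v => ⟨f.1 v, apply_mem_orthogonal_of_mem_isometryStabilizer f.2 v.2⟩
      invFun := fun v => ⟨f.1.symm v,
        apply_mem_orthogonal_of_mem_isometryStabilizer (inv_mem f.2) v.2⟩
      map_add' := fun v w => Subtype.ext (map_add f.1 (v : E) w)
      map_smul' := fun c v => Subtype.ext (map_smul f.1 c (v : E))
      left_inv := fun v => Subtype.ext (f.1.symm_apply_apply v)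
      right_inv := fun v => Subtype.ext (f.1.apply_symm_apply v)
      norm_map' := fun v => f.1.norm_map v }
  map_one' := rfl
  map_mul' _ _ := rfl

theorem isometryStabilizerRestrict_injective (x : E) :
    Function.Injective (isometryStabilizerRestrict x) := by
  intro f g hfg
  have hfx : f.1 x = x := f.2
  have hgx : g.1 x = x := g.2
  ext v
  obtain ⟨y, hy, z, hz, rfl⟩ := (ℝ ∙ x).exists_add_mem_mem_orthogonal v
  obtain ⟨c, rfl⟩ := mem_span_singleton.mp hy
  have hfgz : f.1 z = g.1 z :=
    congrArg (fun h : (ℝ ∙ x)ᗮ ≃ₗᵢ[ℝ] (ℝ ∙ x)ᗮ => (h ⟨z, hz⟩ : E)) hfg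
  simp [hfx, hgx, hfgz]

/-- Extension of an isometry of `Kᗮ` to the whole space by the identity on `K`. -/
noncomputable def extendOrthogonal (K : Submodule ℝ E) [K.HasOrthogonalProjection]
    (g : Kᗮ ≃ₗᵢ[ℝ] Kᗮ) : E ≃ₗᵢ[ℝ] E :=
  (K.orthogonalDecomposition.trans
    (LinearIsometryEquiv.withLpProdCongr 2 (.refl ℝ K) g)).trans K.orthogonalDecomposition.symm

theorem extendOrthogonal_apply (K : Submodule ℝ E) [K.HasOrthogonalProjection]
    (g : Kᗮ ≃ₗᵢ[ℝ] Kᗮ) (v : E) :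
    extendOrthogonal K g v = K.orthogonalProjectionOnto v + g (Kᗮ.orthogonalProjectionOnto v) := by
  simp [extendOrthogonal]

theorem extendOrthogonal_apply_of_mem (K : Submodule ℝ E) [K.HasOrthogonalProjection]
    (g : Kᗮ ≃ₗᵢ[ℝ] Kᗮ) {v : E} (hv : v ∈ K) : extendOrthogonal K g v = v := by
  rw [extendOrthogonal_apply, orthogonalProjectionOnto_orthogonal_apply_eq_zero hv]
  simp [starProjection_eq_self_iff.mpr hv]

theorem extendOrthogonal_apply_coe (K : Submodule ℝ E) [K.HasOrthogonalProjection]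
    (g : Kᗮ ≃ₗᵢ[ℝ] Kᗮ) (v : Kᗮ) : extendOrthogonal K g v = g v := by
  rw [extendOrthogonal_apply, orthogonalProjectionOnto_apply_of_mem_orthogonal v.2]
  simp

theorem isometryStabilizerRestrict_surjective (x : E) :
    Function.Surjective (isometryStabilizerRestrict x) := fun g =>
  ⟨⟨extendOrthogonal (ℝ ∙ x) g,
    extendOrthogonal_apply_of_mem _ g (mem_span_singleton_self x)⟩,
    LinearIsometryEquiv.ext fun v => Subtype.ext (extendOrthogonal_apply_coe _ g v)⟩

end

/-- For a unit vector `x` in a finite-dimensional real inner product space `E`, the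
stabilizer of `x` in the isometry group of `E` is isomorphic, as a group, to the group of
linear isometric equivalences of the orthogonal complement `(ℝ∙x)ᗮ`. -/
theorem isometryStabilizer_iso_orthogonal_complement (E : Type*) [NormedAddCommGroup E]
    [InnerProductSpace ℝ E] [FiniteDimensional ℝ E] (x : E) (hx : ‖x‖ = 1) :
    Nonempty (isometryStabilizer E x ≃* ((ℝ ∙ x)ᗮ ≃ₗᵢ[ℝ] (ℝ ∙ x)ᗮ)) := by
  exact ⟨MulEquiv.ofBijective (isometryStabilizerRestrict x)
    ⟨isometryStabilizerRestrict_injective x, isometryStabilizerRestrict_surjective x⟩⟩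
end

section
/- For every n ≥ 1, the orthogonal group O(n) = Matrix.orthogonalGroup (Fin n) ℝ has exactly two connected components: the subsets {A | det A = 1} and {A | det A = −1} are both nonempty, path-connected, closed and open, and they partition O(n). (This is the statement π₀(O(n)) = ℤ₂ appearing in the paper's table of homotopy groups of O(n), the k = 0 entry which is killed in passing from O(n) to SO(n).) -/
open Matrix

namespace Matrix.orthogonalGroup

variable {ι : Type*} [Fintype ι] [DecidableEq ι]

/-- The orthogonal group as the group of linear isometries of Euclidean space. -/
noncomputable def linearIsometryEquiv (ι : Type*) [Fintype ι] [DecidableEq ι] :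
    orthogonalGroup ι ℝ ≃* (EuclideanSpace ℝ ι ≃ₗᵢ[ℝ] EuclideanSpace ℝ ι) :=
  (Unitary.mapEquiv
    { (toEuclideanCLM (n := ι) (𝕜 := ℝ)).toMulEquiv with
      map_star' := fun A => map_star (toEuclideanCLM (n := ι) (𝕜 := ℝ)) A }).toMulEquiv.trans
    Unitary.linearIsometryEquiv

theorem coe_linearIsometryEquiv_symm (φ : EuclideanSpace ℝ ι ≃ₗᵢ[ℝ] EuclideanSpace ℝ ι) :
    (((linearIsometryEquiv ι).symm φ : orthogonalGroup ι ℝ) : Matrix ι ι ℝ) =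
      LinearMap.toMatrix (EuclideanSpace.basisFun ι ℝ).toBasis
        (EuclideanSpace.basisFun ι ℝ).toBasis φ.toLinearMap :=
  rfl

/-- The matrix of the reflection in the hyperplane orthogonal to `v`. -/
noncomputable def householder (v : EuclideanSpace ℝ ι) : orthogonalGroup ι ℝ :=
  (linearIsometryEquiv ι).symm (ℝ ∙ v)ᗮ.reflection

theorem householder_apply (v : EuclideanSpace ℝ ι) (i j : ι) :
    (householder v : Matrix ι ι ℝ) i j = (1 : Matrix ι ι ℝ) i j - 2 * (v j / ‖v‖ ^ 2) * v i := by
  rw [householder, coe_linearIsometryEquiv_symm, LinearMap.toMatrix_apply]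
  simp [Submodule.reflection_orthogonal_apply, Submodule.reflection_singleton_apply,
    Matrix.one_apply, EuclideanSpace.inner_single_right]
  ring

theorem householder_zero : householder (0 : EuclideanSpace ℝ ι) = 1 := by
  ext i j
  simp [householder_apply]

theorem householder_neg (v : EuclideanSpace ℝ ι) : householder (-v) = householder v := by
  ext i j
  simp [householder_apply, neg_div]

theorem householder_mul_self (v : EuclideanSpace ℝ ι) : householder v * householder v = 1 := by
  rw [householder, ← map_mul, Submodule.reflection_mul_reflection, map_one]

theorem det_householder {v : EuclideanSpace ℝ ι} (hv : v ≠ 0) :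
    (householder v : Matrix ι ι ℝ).det = -1 := by
  rw [householder, coe_linearIsometryEquiv_symm, LinearMap.det_toMatrix, Submodule.det_reflection,
    Submodule.orthogonal_orthogonal, finrank_span_singleton hv, pow_one]

theorem continuousOn_householder :
    ContinuousOn (householder : EuclideanSpace ℝ ι → orthogonalGroup ι ℝ) {0}ᶜ := by
  rw [Topology.IsInducing.subtypeVal.continuousOn_iff]
  refine continuousOn_pi.2 fun i => continuousOn_pi.2 fun j => ?_
  simp only [Function.comp_apply, householder_apply]
  have h : ∀ v ∈ ({0}ᶜ : Set (EuclideanSpace ℝ ι)), ‖v‖ ^ 2 ≠ 0 := fun v hv => by simpa using hv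
  fun_prop (disch := assumption)

theorem joined_householder_of_inner_nonneg {v w : EuclideanSpace ℝ ι} (hv : v ≠ 0) (hw : w ≠ 0)
    (h : 0 ≤ inner ℝ v w) : Joined (householder v) (householder w) := by
  have hseg : segment ℝ v w ⊆ {0}ᶜ := by
    rintro _ ⟨a, b, ha, hb, hab, rfl⟩ h0
    have hv' : 0 < inner ℝ v v := real_inner_self_pos.2 hv
    have h1 : inner ℝ v (a • v + b • w) = 0 := by rw [h0, inner_zero_right]
    simp only [inner_add_right, real_inner_smul_right] at h1
    have ha0 : a = 0 := by
      by_contra hne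
      have := mul_pos (lt_of_le_of_ne ha (Ne.symm hne)) hv'
      nlinarith [mul_nonneg hb h]
    rw [ha0, zero_add] at hab
    exact hw (by simpa [ha0, hab] using h0)
  have hj : JoinedIn (segment ℝ v w) v w :=
    ((convex_segment v w).isPathConnected ⟨v, left_mem_segment ℝ v w⟩).joinedIn
      v (left_mem_segment ℝ v w) w (right_mem_segment ℝ v w)
  exact (hj.map_continuousOn (continuousOn_householder.mono hseg)).joined

theorem joined_householder {v w : EuclideanSpace ℝ ι} (hv : v ≠ 0) (hw : w ≠ 0) :
    Joined (householder v) (householder w) := by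
  rcases le_total 0 (inner ℝ v w) with h | h
  · exact joined_householder_of_inner_nonneg hv hw h
  · rw [← householder_neg w]
    exact joined_householder_of_inner_nonneg hv (neg_ne_zero.2 hw) (by simpa using h)

theorem joined_one_or_householder {v : EuclideanSpace ℝ ι} (hv : v ≠ 0) (A : orthogonalGroup ι ℝ) :
    Joined A 1 ∨ Joined A (householder v) := by
  obtain ⟨l, -, hl⟩ := (linearIsometryEquiv ι A).reflections_generate_dim
  have hA : A = (l.map householder).prod := by
    rw [← (linearIsometryEquiv ι).symm_apply_apply A, hl, map_list_prod, List.map_map]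
    rfl
  subst hA
  clear hl
  induction l with
  | nil => exact Or.inl (Joined.refl _)
  | cons w l ih =>
    rw [List.map_cons, List.prod_cons]
    by_cases hw : w = 0
    · rwa [hw, householder_zero, one_mul]
    · rcases ih with ih | ih
      · exact Or.inr (by simpa using (joined_householder hw hv).mul ih)
      · exact Or.inl (by simpa [householder_mul_self] using (joined_householder hw hv).mul ih)

theorem det_eq_one_or_neg_one (A : orthogonalGroup ι ℝ) :
    (A : Matrix ι ι ℝ).det = 1 ∨ (A : Matrix ι ι ℝ).det = -1 := by
  have h := congrArg Matrix.det ((mem_orthogonalGroup_iff ι ℝ).1 A.2)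
  rw [det_mul, det_transpose, det_one] at h
  exact mul_self_eq_one_iff.1 h

theorem continuous_det :
    Continuous fun A : orthogonalGroup ι ℝ => (A : Matrix ι ι ℝ).det :=
  continuous_subtype_val.matrix_det

theorem isClosed_det_eq (c : ℝ) :
    IsClosed {A : orthogonalGroup ι ℝ | (A : Matrix ι ι ℝ).det = c} :=
  isClosed_singleton.preimage continuous_det

theorem isOpen_det_eq_one : IsOpen {A : orthogonalGroup ι ℝ | (A : Matrix ι ι ℝ).det = 1} := by
  convert (isClosed_det_eq (ι := ι) (-1)).isOpen_compl using 1
  ext A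
  rcases det_eq_one_or_neg_one A with h | h <;> simp [h] <;> norm_num

theorem isOpen_det_eq_neg_one :
    IsOpen {A : orthogonalGroup ι ℝ | (A : Matrix ι ι ℝ).det = -1} := by
  convert (isClosed_det_eq (ι := ι) 1).isOpen_compl using 1
  ext A
  rcases det_eq_one_or_neg_one A with h | h <;> simp [h] <;> norm_num

theorem isClopen_det_eq {c : ℝ} (hc : c = 1 ∨ c = -1) :
    IsClopen {A : orthogonalGroup ι ℝ | (A : Matrix ι ι ℝ).det = c} := by
  refine ⟨isClosed_det_eq c, ?_⟩
  rcases hc with rfl | rfl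
  exacts [isOpen_det_eq_one, isOpen_det_eq_neg_one]

theorem joinedIn_det_eq {A B : orthogonalGroup ι ℝ} (h : Joined A B) :
    JoinedIn {C : orthogonalGroup ι ℝ | (C : Matrix ι ι ℝ).det = (A : Matrix ι ι ℝ).det} A B := by
  refine ⟨h.somePath, fun t => ?_⟩
  exact (isPreconnected_range h.somePath.continuous).subset_isClopen
    (isClopen_det_eq (det_eq_one_or_neg_one A)) ⟨A, ⟨0, h.somePath.source⟩, rfl⟩ ⟨t, rfl⟩

theorem joinedIn_of_det_eq [Nonempty ι] {A B : orthogonalGroup ι ℝ}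
    (h : (A : Matrix ι ι ℝ).det = (B : Matrix ι ι ℝ).det) :
    JoinedIn {C : orthogonalGroup ι ℝ | (C : Matrix ι ι ℝ).det = (A : Matrix ι ι ℝ).det} A B := by
  obtain ⟨v, hv⟩ := exists_ne (0 : EuclideanSpace ℝ ι)
  have hdet := det_householder hv
  have hne : (1 : Matrix ι ι ℝ).det ≠ (householder v : Matrix ι ι ℝ).det := by
    rw [hdet, det_one]; norm_num
  apply joinedIn_det_eq
  rcases joined_one_or_householder hv A with hA | hA <;>
    rcases joined_one_or_householder hv B with hB | hB
  · exact hA.trans hB.symm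
  · exact absurd ((joinedIn_det_eq hA).target_mem.trans
      (h.trans (joinedIn_det_eq hB).target_mem.symm)) hne
  · exact absurd ((joinedIn_det_eq hB).target_mem.trans
      (h.symm.trans (joinedIn_det_eq hA).target_mem.symm)) hne
  · exact hA.trans hB.symm

theorem isPathConnected_det_eq [Nonempty ι] {c : ℝ}
    (hc : {A : orthogonalGroup ι ℝ | (A : Matrix ι ι ℝ).det = c}.Nonempty) :
    IsPathConnected {A : orthogonalGroup ι ℝ | (A : Matrix ι ι ℝ).det = c} := by
  obtain ⟨A, rfl⟩ := hc
  exact ⟨A, rfl, fun _ hB => joinedIn_of_det_eq (Eq.symm hB)⟩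

end Matrix.orthogonalGroup

/-- For `n ≥ 1` the orthogonal group `O(n)` has exactly two connected components:
the subsets of matrices of determinant `1` and of determinant `−1` are nonempty,
path-connected, closed, open, and partition `O(n)`. -/
theorem orthogonalGroup_two_components (n : ℕ) (hn : 1 ≤ n) :
    ({A : Matrix.orthogonalGroup (Fin n) ℝ |
        Matrix.det (A : Matrix (Fin n) (Fin n) ℝ) = 1}.Nonempty) ∧
    ({A : Matrix.orthogonalGroup (Fin n) ℝ |
        Matrix.det (A : Matrix (Fin n) (Fin n) ℝ) = -1}.Nonempty) ∧
    IsPathConnected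
      {A : Matrix.orthogonalGroup (Fin n) ℝ | Matrix.det (A : Matrix (Fin n) (Fin n) ℝ) = 1} ∧
    IsPathConnected
      {A : Matrix.orthogonalGroup (Fin n) ℝ | Matrix.det (A : Matrix (Fin n) (Fin n) ℝ) = -1} ∧
    IsClosed
      {A : Matrix.orthogonalGroup (Fin n) ℝ | Matrix.det (A : Matrix (Fin n) (Fin n) ℝ) = 1} ∧
    IsClosed
      {A : Matrix.orthogonalGroup (Fin n) ℝ | Matrix.det (A : Matrix (Fin n) (Fin n) ℝ) = -1} ∧
    IsOpen
      {A : Matrix.orthogonalGroup (Fin n) ℝ | Matrix.det (A : Matrix (Fin n) (Fin n) ℝ) = 1} ∧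
    IsOpen
      {A : Matrix.orthogonalGroup (Fin n) ℝ | Matrix.det (A : Matrix (Fin n) (Fin n) ℝ) = -1} ∧
    ({A : Matrix.orthogonalGroup (Fin n) ℝ | Matrix.det (A : Matrix (Fin n) (Fin n) ℝ) = 1} ∪
      {A : Matrix.orthogonalGroup (Fin n) ℝ | Matrix.det (A : Matrix (Fin n) (Fin n) ℝ) = -1} =
        Set.univ) ∧
    ({A : Matrix.orthogonalGroup (Fin n) ℝ | Matrix.det (A : Matrix (Fin n) (Fin n) ℝ) = 1} ∩
      {A : Matrix.orthogonalGroup (Fin n) ℝ | Matrix.det (A : Matrix (Fin n) (Fin n) ℝ) = -1} =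
        ∅) := by
  have : NeZero n := ⟨by omega⟩
  obtain ⟨v, hv⟩ := exists_ne (0 : EuclideanSpace ℝ (Fin n))
  have hone : {A : Matrix.orthogonalGroup (Fin n) ℝ |
      Matrix.det (A : Matrix (Fin n) (Fin n) ℝ) = 1}.Nonempty := ⟨1, Matrix.det_one⟩
  have hneg : {A : Matrix.orthogonalGroup (Fin n) ℝ |
      Matrix.det (A : Matrix (Fin n) (Fin n) ℝ) = -1}.Nonempty :=
    ⟨orthogonalGroup.householder v, orthogonalGroup.det_householder hv⟩
  refine ⟨hone, hneg, orthogonalGroup.isPathConnected_det_eq hone,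
    orthogonalGroup.isPathConnected_det_eq hneg, orthogonalGroup.isClosed_det_eq 1,
    orthogonalGroup.isClosed_det_eq (-1), orthogonalGroup.isOpen_det_eq_one,
    orthogonalGroup.isOpen_det_eq_neg_one,
    Set.eq_univ_of_forall orthogonalGroup.det_eq_one_or_neg_one, ?_⟩
  refine Set.eq_empty_of_forall_notMem fun _ ⟨h₁, h₂⟩ => ?_
  have h : (1 : ℝ) = -1 := h₁.symm.trans h₂
  norm_num at h
end
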